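/- For every odd L ≥ 1, the matrix product H_L · H_Lᵀ over GF(2) is the zero matrix; equivalently, for all row indices i, k ∈ {1,…,2^{L−1}} (including i = k), the supports of row i and row k of H_L intersect in an even number of columns. Consequently, when L is odd, every logical X operator X̄_i of the Z-TGRE code (whose support is row i of H_L) commutes with every stabilizer generator S_k. -/

import Mathlib

/-- The permutation `P_{M+1}` (paper index `M+1`) of the `2^(M+1)` columns,
exchanging the two members of each consecutive pair (0-indexed: `2k ↔ 2k+1`). -/
def pairSwap (M : ℕ) : Fin (2 ^ (M + 1)) → Fin (2 ^ (M + 1)) := fun c =>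
  if _h : c.val % 2 = 0 then
    ⟨c.val + 1, by
      have hc := c.isLt
      have h2 : (2:ℕ) ^ (M + 1) = 2 * 2 ^ M := by ring
      omega⟩
  else
    ⟨c.val - 1, by have hc := c.isLt; omega⟩

/-- `Hmat L` is the parity-check matrix `H_{L+1}` of the paper (paper index shifted by one),
a `2^L × 2^(L+1)` matrix over GF(2), defined recursively.  Rows and columns are 0-indexed:
0-indexed row `r` is paper row `r+1`, 0-indexed column `c` is paper column `c+1`. -/
def Hmat : (L : ℕ) → Matrix (Fin (2 ^ L)) (Fin (2 ^ (L + 1))) (ZMod 2)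
  | 0 => Matrix.of fun _ _ => 1
  | (L + 1) => Matrix.of fun r c =>
    have hr : r.val / 2 < 2 ^ L := by
      have h := r.isLt
      have h2 : (2:ℕ) ^ (L + 1) = 2 * 2 ^ L := by ring
      omega
    have hc : c.val / 2 < 2 ^ (L + 1) := by
      have h := c.isLt
      have h2 : (2:ℕ) ^ (L + 1 + 1) = 2 * 2 ^ (L + 1) := by ring
      omega
    if c.val % 2 = 1 then (if c.val = 2 * r.val + 1 then 1 else 0)
    else if r.val % 2 = 1 then Hmat L ⟨r.val / 2, hr⟩ (pairSwap L ⟨c.val / 2, hc⟩)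
    else Hmat L ⟨r.val / 2, hr⟩ ⟨c.val / 2, hc⟩

/-- The Hamming weight of a vector over GF(2): the number of nonzero coordinates. -/
def hamWt {n : ℕ} (v : Fin n → ZMod 2) : ℕ :=
  (Finset.univ.filter (fun c => v c ≠ 0)).card

/-- The square block of `Hmat L` formed by its columns of even 0-index, as a function of
natural numbers. -/
def evenBlock : ℕ → ℕ → ℕ → ZMod 2
  | 0, _, _ => 1
  | L + 1, r, s =>
    if r % 2 = s % 2 then evenBlock L (r / 2) (s / 2) else if r / 2 = s / 2 then 1 else 0

theorem evenBlock_comm (L r s : ℕ) : evenBlock L r s = evenBlock L s r := by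
  induction L generalizing r s with
  | zero => rfl
  | succ L ih => simp only [evenBlock, eq_comm (a := r % 2), eq_comm (a := r / 2), ih (r / 2)]

theorem Hmat_apply (L : ℕ) (r : Fin (2 ^ L)) (c : Fin (2 ^ (L + 1))) :
    Hmat L r c =
      if c.val % 2 = 1 then (if r.val = c.val / 2 then 1 else 0)
      else evenBlock L r (c.val / 2) := by
  induction L with
  | zero =>
    have hc := c.isLt
    have h : c.val / 2 = 0 := by omega
    simp [Hmat, evenBlock, h]
  | succ L ih =>
    simp only [Hmat, Matrix.of_apply, ih, pairSwap, evenBlock]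
    split_ifs <;> grind

theorem sum_range_two_mul {M : Type*} [AddCommMonoid M] (f : ℕ → M) (n : ℕ) :
    ∑ i ∈ Finset.range (2 * n), f i =
      ∑ i ∈ Finset.range n, (f (2 * i) + f (2 * i + 1)) := by
  induction n with
  | zero => simp
  | succ n ih => rw [Nat.mul_succ, Finset.sum_range_succ, Finset.sum_range_succ, ih,
      Finset.sum_range_succ, add_assoc]

theorem sum_evenBlock_mul (L r k : ℕ) (hr : r < 2 ^ L) (hk : k < 2 ^ L) :
    ∑ s ∈ Finset.range (2 ^ L), evenBlock L r s * evenBlock L k s =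
      if r = k then (L : ZMod 2) + 1 else 0 := by
  induction L generalizing r k with
  | zero =>
    have h : r = k := by omega
    simp [evenBlock, h]
  | succ L ih =>
    have hr' : r / 2 < 2 ^ L := by omega
    have hk' : k / 2 < 2 ^ L := by omega
    have hdiv (m : ℕ) : (2 * m + 1) / 2 = m := by omega
    have hmod (m : ℕ) : (2 * m + 1) % 2 = 1 := by omega
    have hih := ih _ _ hr' hk'
    rw [pow_succ', sum_range_two_mul]
    simp only [evenBlock, hdiv, hmod, Nat.mul_mod_right,
      Nat.mul_div_cancel_left _ (Nat.zero_lt_two)]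
    have hcomm := evenBlock_comm L (r / 2) (k / 2)
    rcases Nat.mod_two_eq_zero_or_one r with h | h <;>
      rcases Nat.mod_two_eq_zero_or_one k with h' | h'
    · have hiff : r = k ↔ r / 2 = k / 2 := by omega
      by_cases e : r / 2 = k / 2 <;>
        simp_all [Finset.sum_add_distrib]
    · have hne : r ≠ k := by omega
      simp_all [Finset.sum_add_distrib, CharTwo.add_self_eq_zero]
    · have hne : r ≠ k := by omega
      simp_all [Finset.sum_add_distrib, CharTwo.add_self_eq_zero]
    · have hiff : r = k ↔ r / 2 = k / 2 := by omega
      by_cases e : r / 2 = k / 2 <;>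
        simp_all [Finset.sum_add_distrib, add_comm]

theorem Hmat_mul_transpose_apply (L : ℕ) (r k : Fin (2 ^ L)) :
    (Hmat L * (Hmat L).transpose) r k = if r = k then (L : ZMod 2) else 0 := by
  have hdiv (m : ℕ) : (2 * m + 1) / 2 = m := by omega
  have hmod (m : ℕ) : (2 * m + 1) % 2 = 1 := by omega
  simp only [Matrix.mul_apply, Matrix.transpose_apply, Hmat_apply]
  rw [Fin.sum_univ_eq_sum_range (fun c =>
      (if c % 2 = 1 then (if r.val = c / 2 then 1 else 0) else evenBlock L r (c / 2)) *
      (if c % 2 = 1 then (if k.val = c / 2 then 1 else 0) else evenBlock L k (c / 2))),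
    pow_succ', sum_range_two_mul]
  simp only [hdiv, hmod, Nat.mul_mod_right, Nat.mul_div_cancel_left _ (Nat.zero_lt_two),
    Finset.sum_add_distrib, zero_ne_one, if_false, if_true,
    sum_evenBlock_mul L r k r.isLt k.isLt]
  by_cases e : r = k
  · subst e
    simp [add_assoc, CharTwo.add_self_eq_zero]
  · have e' : r.val ≠ k.val := Fin.val_ne_of_ne e
    simp [e, e']

theorem even_card_of_sum_mul_eq_zero {ι : Type*} [Fintype ι] (u v : ι → ZMod 2)
    (h : ∑ c, u c * v c = 0) :
    Even (Finset.univ.filter (fun c => u c ≠ 0 ∧ v c ≠ 0)).card := by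
  have hmul : ∀ a b : ZMod 2, a * b = if a ≠ 0 ∧ b ≠ 0 then 1 else 0 := by decide
  rw [← ZMod.natCast_eq_zero_iff_even, ← Finset.sum_boole]
  simpa only [hmul] using h

/-- For every odd `L ≥ 1` (paper index, `Hmat (L-1)` is the paper's `H_L`),
`H_L ⬝ H_Lᵀ = 0` over GF(2); equivalently, for all row indices `i, k`, the supports of
rows `i` and `k` of `H_L` intersect in an even number of columns.  Hence for odd `L`
every logical X operator `X̄_i` (supported on row `i`) commutes with every stabilizer
generator `S_k`. -/
theorem odd_L_rows_orthogonal (L : ℕ) (hL : 1 ≤ L) (hodd : Odd L) :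
    Hmat (L - 1) * (Hmat (L - 1)).transpose = 0 ∧
    ∀ i k : Fin (2 ^ (L - 1)),
      Even ((Finset.univ.filter (fun c : Fin (2 ^ (L - 1 + 1)) =>
        Hmat (L - 1) i c ≠ 0 ∧ Hmat (L - 1) k c ≠ 0)).card) := by
  have hzero : Hmat (L - 1) * (Hmat (L - 1)).transpose = 0 := by
    ext i k
    have heven : ((L - 1 : ℕ) : ZMod 2) = 0 :=
      ZMod.natCast_eq_zero_iff_even.mpr (Nat.Odd.sub_odd hodd odd_one)
    simp [Hmat_mul_transpose_apply, heven]
  refine ⟨hzero, fun i k => even_card_of_sum_mul_eq_zero _ _ ?_⟩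
  simpa [Matrix.mul_apply] using congrFun (congrFun hzero i) k
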